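/- arXiv:1911.08987 — 10 statements merged into one kernel-verified Lean document; each statement's English description precedes it below -/
import Mathlib

section
/- Let g : ℝⁿ → ℝ be convex, s ∈ ℝⁿ, x₁ ∈ ℝⁿ, and 0 < λ₁ < λ₂. Define, for λ > 0, D(λ) = −2λ · inf_{u ∈ ℝⁿ} [⟨s, u − x₁⟩ + (λ/2)‖u − x₁‖² + g(u) − g(x₁)]. Then D(λ₂) ≥ D(λ₁). -/
open RealInnerProductSpace

/-- Along a segment starting at `x`, the increment of a convex function is at most linear. -/
lemma ConvexOn.sub_le_mul_sub_of_univ {E : Type*} [AddCommGroup E] [Module ℝ E] {g : E → ℝ}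
    (hg : ConvexOn ℝ Set.univ g) (x u : E) {t : ℝ} (ht₀ : 0 ≤ t) (ht₁ : t ≤ 1) :
    g (x + t • (u - x)) - g x ≤ t * (g u - g x) := by
  have h := hg.2 (Set.mem_univ x) (Set.mem_univ u) (sub_nonneg.2 ht₁) ht₀ (by ring)
  have hx : (1 - t) • x + t • u = x + t • (u - x) := by module
  rw [hx, smul_eq_mul, smul_eq_mul] at h
  linarith

/-- A convex function on a finite-dimensional space decreases at most linearly away from `x`. -/
lemma ConvexOn.exists_neg_mul_one_add_norm_le {E : Type*} [NormedAddCommGroup E]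
    [NormedSpace ℝ E] [FiniteDimensional ℝ E] {g : E → ℝ} (hg : ConvexOn ℝ Set.univ g) (x : E) :
    ∃ C : ℝ, ∀ u, -C * (1 + ‖u - x‖) ≤ g u - g x := by
  have : ProperSpace E := FiniteDimensional.proper ℝ E
  have hc : ContinuousOn g (Metric.closedBall x 1) :=
    (hg.continuousOn isOpen_univ).mono (Set.subset_univ _)
  obtain ⟨m, hm⟩ := (isCompact_closedBall x 1).bddBelow_image hc
  refine ⟨g x - m, fun u => ?_⟩
  have hr : 0 < 1 + ‖u - x‖ := by positivity
  have ht₁ : (1 + ‖u - x‖)⁻¹ ≤ 1 := inv_le_one_of_one_le₀ (by linarith [norm_nonneg (u - x)])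
  have hmem : x + (1 + ‖u - x‖)⁻¹ • (u - x) ∈ Metric.closedBall x 1 := by
    rw [mem_closedBall_iff_norm, add_sub_cancel_left, norm_smul, Real.norm_of_nonneg (by positivity),
      inv_mul_le_iff₀ hr]
    linarith
  have h₁ := hm (Set.mem_image_of_mem g hmem)
  have h₂ := hg.sub_le_mul_sub_of_univ x u (by positivity) ht₁
  have h₃ : m - g x ≤ (1 + ‖u - x‖)⁻¹ * (g u - g x) := by linarith
  rw [le_inv_mul_iff₀ hr] at h₃
  linarith

/-- A convex function plus a linear term plus a proximal term is bounded below. -/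
lemma ConvexOn.bddBelow_range_inner_add_sq {E : Type*} [NormedAddCommGroup E]
    [InnerProductSpace ℝ E] [FiniteDimensional ℝ E] {g : E → ℝ} (hg : ConvexOn ℝ Set.univ g)
    (s x : E) {c : ℝ} (hc : 0 < c) :
    BddBelow (Set.range fun u : E => ⟪s, u - x⟫ + c / 2 * ‖u - x‖ ^ 2 + g u - g x) := by
  obtain ⟨C, hC⟩ := hg.exists_neg_mul_one_add_norm_le x
  refine ⟨-C - (‖s‖ + C) ^ 2 / (2 * c), ?_⟩
  rintro _ ⟨u, rfl⟩
  have h₁ := hC u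
  have h₂ := (abs_le.1 (abs_real_inner_le_norm s (u - x))).1
  have h₃ : c / 2 * ‖u - x‖ ^ 2 - (‖s‖ + C) * ‖u - x‖ + (‖s‖ + C) ^ 2 / (2 * c)
      = (c * ‖u - x‖ - (‖s‖ + C)) ^ 2 / (2 * c) := by
    field_simp
    ring
  have h₄ : 0 ≤ (c * ‖u - x‖ - (‖s‖ + C)) ^ 2 / (2 * c) := by positivity
  dsimp only
  linarith



/-- For convex `g : ℝⁿ → ℝ`, `s, x₁ ∈ ℝⁿ` and `0 < λ₁ < λ₂`, the quantity
`D(λ) = −2λ · inf_{u ∈ ℝⁿ} [⟪s, u − x₁⟫ + (λ/2)‖u − x₁‖² + g u − g x₁]` satisfies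
`D(λ₂) ≥ D(λ₁)`. -/
theorem stmt_2 {n : ℕ} (g : EuclideanSpace ℝ (Fin n) → ℝ)
    (hg : ConvexOn ℝ Set.univ g) (s x₁ : EuclideanSpace ℝ (Fin n))
    (lam₁ lam₂ : ℝ) (hlam₁ : 0 < lam₁) (hlam : lam₁ < lam₂) :
    -2 * lam₂ *
        sInf (Set.range fun u : EuclideanSpace ℝ (Fin n) =>
          ⟪s, u - x₁⟫ + lam₂ / 2 * ‖u - x₁‖ ^ 2 + g u - g x₁) ≥
      -2 * lam₁ *
        sInf (Set.range fun u : EuclideanSpace ℝ (Fin n) =>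
          ⟪s, u - x₁⟫ + lam₁ / 2 * ‖u - x₁‖ ^ 2 + g u - g x₁) := by

  have hlam₂ : 0 < lam₂ := hlam₁.trans hlam
  have hbdd := hg.bddBelow_range_inner_add_sq s x₁ hlam₂
  suffices h : lam₂ / lam₁ * sInf (Set.range fun u : EuclideanSpace ℝ (Fin n) =>
      ⟪s, u - x₁⟫ + lam₂ / 2 * ‖u - x₁‖ ^ 2 + g u - g x₁) ≤
      sInf (Set.range fun u : EuclideanSpace ℝ (Fin n) =>
        ⟪s, u - x₁⟫ + lam₁ / 2 * ‖u - x₁‖ ^ 2 + g u - g x₁) by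
    rw [div_mul_eq_mul_div, div_le_iff₀ hlam₁] at h
    linarith
  refine le_csInf (Set.range_nonempty _) ?_
  rintro _ ⟨u, rfl⟩
  have h₁ := csInf_le hbdd (Set.mem_range_self (x₁ + (lam₁ / lam₂) • (u - x₁)))
  have h₂ := hg.sub_le_mul_sub_of_univ x₁ u (t := lam₁ / lam₂) (by positivity)
    ((div_le_one hlam₂).2 hlam.le)
  simp only [add_sub_cancel_left, inner_smul_right, norm_smul, mul_pow, Real.norm_eq_abs,
    sq_abs] at h₁
  have h₃ : lam₂ / 2 * ((lam₁ / lam₂) ^ 2 * ‖u - x₁‖ ^ 2)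
      = lam₁ / lam₂ * (lam₁ / 2 * ‖u - x₁‖ ^ 2) := by
    field_simp
  rw [← inv_div, inv_mul_le_iff₀ (by positivity)]
  linarith
end

section
/- Suppose f is (L₁,L₂)-block smooth, g₁ and g₂ are convex, and let T ∈ Q₁ minimize u ↦ ⟨∇₁f(x), u − x₁⟩ + (L₁/2)‖u − x₁‖² + g₁(u) over Q₁, where x = (x₁,x₂) with x₁ ∈ Q₁, x₂ ∈ Q₂. Then F(T, x₂) ≤ F(x) − (1/(2L₁)) · D₁(x, L₁). -/
open RealInnerProductSpace

/-- If `f` is (L₁,L₂)-block smooth, `g₁, g₂` are convex, and `T ∈ Q₁`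
minimizes `u ↦ ⟪∇₁f(x), u − x₁⟫ + (L₁/2)‖u − x₁‖² + g₁ u` over `Q₁`, where
`x = (x₁,x₂) ∈ Q₁ × Q₂`, then `F(T, x₂) ≤ F(x) − (1/(2L₁)) · D₁(x, L₁)`. -/
theorem stmt_4 {H₁ H₂ : Type*} [NormedAddCommGroup H₁] [InnerProductSpace ℝ H₁]
    [NormedAddCommGroup H₂] [InnerProductSpace ℝ H₂]
    (f : H₁ → H₂ → ℝ) (gf1 : H₁ → H₂ → H₁) (gf2 : H₁ → H₂ → H₂)
    (g₁ : H₁ → ℝ) (g₂ : H₂ → ℝ) (Q₁ : Set H₁) (Q₂ : Set H₂)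
    (hQ₁ : Convex ℝ Q₁) (hQ₂ : Convex ℝ Q₂)
    (hg₁ : ConvexOn ℝ Set.univ g₁) (hg₂ : ConvexOn ℝ Set.univ g₂)
    (L₁ L₂ : ℝ) (hL₁ : 0 < L₁)
    (hsm : ∀ (u ξ : H₁) (v η : H₂),
      f u v ≤ f ξ η + ⟪gf1 ξ η, u - ξ⟫ + ⟪gf2 ξ η, v - η⟫
        + L₁ / 2 * ‖u - ξ‖ ^ 2 + L₂ / 2 * ‖v - η‖ ^ 2)
    (x₁ : H₁) (x₂ : H₂) (hx₁ : x₁ ∈ Q₁) (hx₂ : x₂ ∈ Q₂)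
    (T : H₁) (hT : T ∈ Q₁)
    (hTmin : ∀ u ∈ Q₁,
      ⟪gf1 x₁ x₂, T - x₁⟫ + L₁ / 2 * ‖T - x₁‖ ^ 2 + g₁ T ≤
        ⟪gf1 x₁ x₂, u - x₁⟫ + L₁ / 2 * ‖u - x₁‖ ^ 2 + g₁ u) :
    f T x₂ + g₁ T + g₂ x₂ ≤
      (f x₁ x₂ + g₁ x₁ + g₂ x₂) -
        1 / (2 * L₁) *
          (-2 * L₁ *
            sInf {r : ℝ | ∃ u ∈ Q₁,
              r = ⟪gf1 x₁ x₂, u - x₁⟫ + L₁ / 2 * ‖u - x₁‖ ^ 2 + g₁ u - g₁ x₁}) := by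
  have hinf : IsLeast {r : ℝ | ∃ u ∈ Q₁,
      r = ⟪gf1 x₁ x₂, u - x₁⟫ + L₁ / 2 * ‖u - x₁‖ ^ 2 + g₁ u - g₁ x₁}
      (⟪gf1 x₁ x₂, T - x₁⟫ + L₁ / 2 * ‖T - x₁‖ ^ 2 + g₁ T - g₁ x₁) := by
    refine ⟨⟨T, hT, rfl⟩, ?_⟩
    rintro r ⟨u, hu, rfl⟩
    linarith [hTmin u hu]
  rw [hinf.csInf_eq]
  have hscale : ∀ c : ℝ, 1 / (2 * L₁) * (-2 * L₁ * c) = -c := by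
    intro c
    field_simp
  have hdescent := hsm T x₁ x₂ x₂
  simp only [sub_self, inner_zero_right, norm_zero] at hdescent
  rw [hscale]
  linarith
end

section
/- Suppose f is (L₁,L₂)-block smooth with 0 < μ₁ ≤ L₁, g₁ and g₂ are convex, the point x = (x₁,x₂) ∈ Q₁ × Q₂ satisfies the proximal PL inequality D₁(x, L₁) ≥ 2μ₁ (F(x) − F*), where F* = inf_{Q₁×Q₂} F, and let T ∈ Q₁ minimize u ↦ ⟨∇₁f(x), u−x₁⟩ + (L₁/2)‖u−x₁‖² + g₁(u) over Q₁. Then F(T, x₂) − F* ≤ (1 − μ₁/L₁) · (F(x) − F*). -/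
open RealInnerProductSpace

/-- If `f` is (L₁,L₂)-block smooth with `0 < μ₁ ≤ L₁`, `g₁, g₂` are convex,
`x = (x₁,x₂) ∈ Q₁ × Q₂` satisfies the proximal PL inequality `D₁(x, L₁) ≥ 2μ₁ (F(x) − F*)`
(where `F* = inf_{Q₁×Q₂} F`), and `T ∈ Q₁` minimizes the `L₁`-proximal subproblem over `Q₁`,
then `F(T, x₂) − F* ≤ (1 − μ₁/L₁) (F(x) − F*)`. -/
theorem stmt_5 {H₁ H₂ : Type*} [NormedAddCommGroup H₁] [InnerProductSpace ℝ H₁]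
    [NormedAddCommGroup H₂] [InnerProductSpace ℝ H₂]
    (f : H₁ → H₂ → ℝ) (gf1 : H₁ → H₂ → H₁) (gf2 : H₁ → H₂ → H₂)
    (g₁ : H₁ → ℝ) (g₂ : H₂ → ℝ) (Q₁ : Set H₁) (Q₂ : Set H₂)
    (hQ₁ : Convex ℝ Q₁) (hQ₂ : Convex ℝ Q₂)
    (hg₁ : ConvexOn ℝ Set.univ g₁) (hg₂ : ConvexOn ℝ Set.univ g₂)
    (μ₁ L₁ L₂ : ℝ) (hμ₁ : 0 < μ₁) (hμL : μ₁ ≤ L₁)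
    (hsm : ∀ (u ξ : H₁) (v η : H₂),
      f u v ≤ f ξ η + ⟪gf1 ξ η, u - ξ⟫ + ⟪gf2 ξ η, v - η⟫
        + L₁ / 2 * ‖u - ξ‖ ^ 2 + L₂ / 2 * ‖v - η‖ ^ 2)
    (x₁ : H₁) (x₂ : H₂) (hx₁ : x₁ ∈ Q₁) (hx₂ : x₂ ∈ Q₂)
    (hPL : -2 * L₁ *
        sInf {r : ℝ | ∃ u ∈ Q₁,
          r = ⟪gf1 x₁ x₂, u - x₁⟫ + L₁ / 2 * ‖u - x₁‖ ^ 2 + g₁ u - g₁ x₁} ≥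
      2 * μ₁ * ((f x₁ x₂ + g₁ x₁ + g₂ x₂) -
        sInf {r : ℝ | ∃ u ∈ Q₁, ∃ v ∈ Q₂, r = f u v + g₁ u + g₂ v}))
    (T : H₁) (hT : T ∈ Q₁)
    (hTmin : ∀ u ∈ Q₁,
      ⟪gf1 x₁ x₂, T - x₁⟫ + L₁ / 2 * ‖T - x₁‖ ^ 2 + g₁ T ≤
        ⟪gf1 x₁ x₂, u - x₁⟫ + L₁ / 2 * ‖u - x₁‖ ^ 2 + g₁ u) :
    f T x₂ + g₁ T + g₂ x₂ -
        sInf {r : ℝ | ∃ u ∈ Q₁, ∃ v ∈ Q₂, r = f u v + g₁ u + g₂ v} ≤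
      (1 - μ₁ / L₁) *
        ((f x₁ x₂ + g₁ x₁ + g₂ x₂) -
          sInf {r : ℝ | ∃ u ∈ Q₁, ∃ v ∈ Q₂, r = f u v + g₁ u + g₂ v}) := by
  have hL : 0 < L₁ := hμ₁.trans_le hμL
  have hmin : sInf {r : ℝ | ∃ u ∈ Q₁,
      r = ⟪gf1 x₁ x₂, u - x₁⟫ + L₁ / 2 * ‖u - x₁‖ ^ 2 + g₁ u - g₁ x₁} =
      ⟪gf1 x₁ x₂, T - x₁⟫ + L₁ / 2 * ‖T - x₁‖ ^ 2 + g₁ T - g₁ x₁ := by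
    refine IsLeast.csInf_eq ⟨⟨T, hT, rfl⟩, ?_⟩
    rintro _ ⟨u, hu, rfl⟩
    exact sub_le_sub_right (hTmin u hu) _
  rw [hmin] at hPL
  have hdescent := hsm T x₁ x₂ x₂
  simp only [sub_self, inner_zero_right, norm_zero] at hdescent
  generalize sInf {r : ℝ | ∃ u ∈ Q₁, ∃ v ∈ Q₂, r = f u v + g₁ u + g₂ v} = Fmin at hPL ⊢
  have hdecrease : μ₁ / L₁ * (f x₁ x₂ + g₁ x₁ + g₂ x₂ - Fmin) ≤
      -(⟪gf1 x₁ x₂, T - x₁⟫ + L₁ / 2 * ‖T - x₁‖ ^ 2 + g₁ T - g₁ x₁) := by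
    rw [div_mul_eq_mul_div, div_le_iff₀ hL]
    linarith
  linarith
end

section
/- Let f : ℝ^{n₁} × ℝ^{n₂} → ℝ be differentiable, (μ₁,μ₂)-block strongly convex and (L₁,L₂)-block smooth with 0 < μ₁ ≤ L₁ and 0 < μ₂ ≤ L₂, let g₁, g₂ be convex, and F = f + g₁ + g₂ with F* = inf F (over all of ℝ^{n₁} × ℝ^{n₂}). Let x = (x₁,x₂) satisfy the block-2 optimality condition ⟨∇₂f(x), v − x₂⟩ + g₂(v) − g₂(x₂) ≥ 0 for all v, let x₁⁺ minimize u ↦ f(u, x₂) + g₁(u) over ℝ^{n₁} and let x₂⁺ minimize v ↦ f(x₁⁺, v) + g₂(v) over ℝ^{n₂} (one full unconstrained alternating-minimization sweep). Then F(x₁⁺, x₂⁺) − F* ≤ (1 − μ₁/L₁)(1 − μ₂/L₂) · (F(x) − F*). -/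
open RealInnerProductSpace

/-- First-order optimality at a minimizer `x` of `h + g`, with `g` convex and `h` bounded above by
a quadratic model with slope `d` at `x`. -/
lemma inner_add_sub_nonneg_of_forall_le {E : Type*} [NormedAddCommGroup E] [InnerProductSpace ℝ E]
    {h g : E → ℝ} (hg : ConvexOn ℝ Set.univ g) {x d : E} {L : ℝ}
    (hsm : ∀ u, h u ≤ h x + ⟪d, u - x⟫ + L / 2 * ‖u - x‖ ^ 2)
    (hmin : ∀ u, h x + g x ≤ h u + g u) (u : E) :
    0 ≤ ⟪d, u - x⟫ + g u - g x := by
  have key : ∀ s ∈ Set.Ioo (0 : ℝ) 1,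
      0 ≤ ⟪d, u - x⟫ + g u - g x + s * (L / 2 * ‖u - x‖ ^ 2) := by
    rintro s ⟨hs0, hs1⟩
    have h1 := hmin (x + s • (u - x))
    have h2 := hsm (x + s • (u - x))
    have h3 := hg.2 (Set.mem_univ x) (Set.mem_univ u) (sub_nonneg.2 hs1.le) hs0.le
      (sub_add_cancel 1 s)
    have h4 : (1 - s) • x + s • u = x + s • (u - x) := by module
    rw [h4, smul_eq_mul, smul_eq_mul] at h3
    rw [add_sub_cancel_left, inner_smul_right, norm_smul, mul_pow, Real.norm_eq_abs, sq_abs] at h2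
    refine nonneg_of_mul_nonneg_right (a := s) ?_ hs0
    linarith
  have hlim : Filter.Tendsto
      (fun s : ℝ => ⟪d, u - x⟫ + g u - g x + s * (L / 2 * ‖u - x‖ ^ 2))
      (nhdsWithin 0 (Set.Ioi 0)) (nhds (⟪d, u - x⟫ + g u - g x)) := by
    have hc : Continuous
        (fun s : ℝ => ⟪d, u - x⟫ + g u - g x + s * (L / 2 * ‖u - x‖ ^ 2)) := by fun_prop
    simpa using (hc.tendsto 0).mono_left nhdsWithin_le_nhds
  refine ge_of_tendsto hlim ?_
  filter_upwards [Ioo_mem_nhdsGT (zero_lt_one' ℝ)] with s hs using key s hs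

/-- Minimizing `h + g` decreases it at least as much as a step of length `μ / L` towards any `u`,
where the value at `u` is measured by the `μ`-quadratic lower model at `x`. -/
lemma le_convexCombo_lower_model {E : Type*} [NormedAddCommGroup E] [InnerProductSpace ℝ E]
    {h g : E → ℝ} (hg : ConvexOn ℝ Set.univ g) {x y d : E} {μ L : ℝ} (hμ : 0 < μ) (hμL : μ ≤ L)
    (hsm : ∀ u, h u ≤ h x + ⟪d, u - x⟫ + L / 2 * ‖u - x‖ ^ 2)
    (hmin : ∀ u, h y + g y ≤ h u + g u) (u : E) :
    h y + g y ≤ (1 - μ / L) * (h x + g x)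
      + μ / L * (h x + ⟪d, u - x⟫ + μ / 2 * ‖u - x‖ ^ 2 + g u) := by
  have hL : 0 < L := hμ.trans_le hμL
  obtain ⟨s, hs⟩ : ∃ s, s = μ / L := ⟨_, rfl⟩
  have hs0 : 0 ≤ s := hs ▸ (div_pos hμ hL).le
  have hs1 : s ≤ 1 := hs ▸ (div_le_one hL).2 hμL
  have hμ' : μ = s * L := by rw [hs, div_mul_cancel₀ _ hL.ne']
  rw [← hs]
  have h1 := hmin (x + s • (u - x))
  have h2 := hsm (x + s • (u - x))
  have h3 := hg.2 (Set.mem_univ x) (Set.mem_univ u) (sub_nonneg.2 hs1) hs0 (sub_add_cancel 1 s)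
  have h4 : (1 - s) • x + s • u = x + s • (u - x) := by module
  rw [h4, smul_eq_mul, smul_eq_mul] at h3
  rw [add_sub_cancel_left, inner_smul_right, norm_smul, mul_pow, Real.norm_eq_abs, sq_abs] at h2
  rw [hμ']
  linarith

/-- A bound of `a` by convex combinations of `b` with all values of `F` contracts the gap to the
infimum. -/
lemma sub_sInf_range_le {ι : Type*} [Nonempty ι] {F : ι → ℝ} {a b t : ℝ} (ht : 0 < t)
    (h : ∀ i, a ≤ (1 - t) * b + t * F i) :
    a - sInf (Set.range F) ≤ (1 - t) * (b - sInf (Set.range F)) := by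
  have : (a - (1 - t) * b) / t ≤ sInf (Set.range F) := by
    refine le_csInf (Set.range_nonempty F) ?_
    rintro _ ⟨i, rfl⟩
    rw [div_le_iff₀ ht]
    linarith [h i]
  rw [div_le_iff₀ ht] at this
  linarith

/-- For `f : ℝ^{n₁} × ℝ^{n₂} → ℝ` differentiable, (μ₁,μ₂)-block strongly convex
and (L₁,L₂)-block smooth with `0 < μ₁ ≤ L₁`, `0 < μ₂ ≤ L₂`, convex `g₁, g₂`,
`F = f + g₁ + g₂` and `F* = inf F`: if `x = (x₁,x₂)` satisfies the block-2 optimality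
condition and `(x₁⁺, x₂⁺)` is one full unconstrained alternating-minimization sweep
starting from `x`, then `F(x₁⁺, x₂⁺) − F* ≤ (1 − μ₁/L₁)(1 − μ₂/L₂)(F(x) − F*)`. -/
theorem stmt_6 {n₁ n₂ : ℕ}
    (f : EuclideanSpace ℝ (Fin n₁) → EuclideanSpace ℝ (Fin n₂) → ℝ)
    (gf1 : EuclideanSpace ℝ (Fin n₁) → EuclideanSpace ℝ (Fin n₂) → EuclideanSpace ℝ (Fin n₁))
    (gf2 : EuclideanSpace ℝ (Fin n₁) → EuclideanSpace ℝ (Fin n₂) → EuclideanSpace ℝ (Fin n₂))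
    (g₁ : EuclideanSpace ℝ (Fin n₁) → ℝ) (g₂ : EuclideanSpace ℝ (Fin n₂) → ℝ)
    (hg₁ : ConvexOn ℝ Set.univ g₁) (hg₂ : ConvexOn ℝ Set.univ g₂)
    (μ₁ μ₂ L₁ L₂ : ℝ) (hμ₁ : 0 < μ₁) (hμ₂ : 0 < μ₂) (hμL₁ : μ₁ ≤ L₁) (hμL₂ : μ₂ ≤ L₂)
    (hsc : ∀ (u ξ : EuclideanSpace ℝ (Fin n₁)) (v η : EuclideanSpace ℝ (Fin n₂)),
      f u v ≥ f ξ η + ⟪gf1 ξ η, u - ξ⟫ + ⟪gf2 ξ η, v - η⟫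
        + μ₁ / 2 * ‖u - ξ‖ ^ 2 + μ₂ / 2 * ‖v - η‖ ^ 2)
    (hsm : ∀ (u ξ : EuclideanSpace ℝ (Fin n₁)) (v η : EuclideanSpace ℝ (Fin n₂)),
      f u v ≤ f ξ η + ⟪gf1 ξ η, u - ξ⟫ + ⟪gf2 ξ η, v - η⟫
        + L₁ / 2 * ‖u - ξ‖ ^ 2 + L₂ / 2 * ‖v - η‖ ^ 2)
    (x₁ : EuclideanSpace ℝ (Fin n₁)) (x₂ : EuclideanSpace ℝ (Fin n₂))
    (hopt : ∀ v : EuclideanSpace ℝ (Fin n₂), ⟪gf2 x₁ x₂, v - x₂⟫ + g₂ v - g₂ x₂ ≥ 0)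
    (x₁p : EuclideanSpace ℝ (Fin n₁))
    (hx₁p : ∀ u : EuclideanSpace ℝ (Fin n₁), f x₁p x₂ + g₁ x₁p ≤ f u x₂ + g₁ u)
    (x₂p : EuclideanSpace ℝ (Fin n₂))
    (hx₂p : ∀ v : EuclideanSpace ℝ (Fin n₂), f x₁p x₂p + g₂ x₂p ≤ f x₁p v + g₂ v) :
    f x₁p x₂p + g₁ x₁p + g₂ x₂p -
        sInf (Set.range fun p : EuclideanSpace ℝ (Fin n₁) × EuclideanSpace ℝ (Fin n₂) =>
          f p.1 p.2 + g₁ p.1 + g₂ p.2) ≤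
      (1 - μ₁ / L₁) * (1 - μ₂ / L₂) *
        ((f x₁ x₂ + g₁ x₁ + g₂ x₂) -
          sInf (Set.range fun p : EuclideanSpace ℝ (Fin n₁) × EuclideanSpace ℝ (Fin n₂) =>
            f p.1 p.2 + g₁ p.1 + g₂ p.2)) := by
  have hL₁ := hμ₁.trans_le hμL₁
  have hL₂ := hμ₂.trans_le hμL₂
  have hsm₁ : ∀ ξ u, f u x₂ ≤ f ξ x₂ + ⟪gf1 ξ x₂, u - ξ⟫ + L₁ / 2 * ‖u - ξ‖ ^ 2 := fun ξ u => by
    simpa using hsm u ξ x₂ x₂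
  have hsm₂ : ∀ v, f x₁p v ≤ f x₁p x₂ + ⟪gf2 x₁p x₂, v - x₂⟫ + L₂ / 2 * ‖v - x₂‖ ^ 2 :=
    fun v => by simpa using hsm x₁p x₁p v x₂
  have hopt₁ := inner_add_sub_nonneg_of_forall_le (h := (f · x₂)) hg₁ (hsm₁ x₁p) hx₁p
  have step₁ := sub_sInf_range_le (a := f x₁p x₂ + g₁ x₁p + g₂ x₂)
    (b := f x₁ x₂ + g₁ x₁ + g₂ x₂)
    (F := fun p : EuclideanSpace ℝ (Fin n₁) × EuclideanSpace ℝ (Fin n₂) =>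
      f p.1 p.2 + g₁ p.1 + g₂ p.2) (div_pos hμ₁ hL₁) (by
    rintro ⟨u, v⟩
    have hle := le_convexCombo_lower_model (h := (f · x₂)) hg₁ hμ₁ hμL₁ (hsm₁ x₁) hx₁p u
    have hmodel : f x₁ x₂ + ⟪gf1 x₁ x₂, u - x₁⟫ + μ₁ / 2 * ‖u - x₁‖ ^ 2 + g₁ u + g₂ x₂
        ≤ f u v + g₁ u + g₂ v := by
      have : 0 ≤ μ₂ / 2 * ‖v - x₂‖ ^ 2 := by positivity
      linarith [hsc u x₁ v x₂, hopt v]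
    have := mul_le_mul_of_nonneg_left hmodel (div_pos hμ₁ hL₁).le
    linarith)
  have step₂ := sub_sInf_range_le (a := f x₁p x₂p + g₁ x₁p + g₂ x₂p)
    (b := f x₁p x₂ + g₁ x₁p + g₂ x₂)
    (F := fun p : EuclideanSpace ℝ (Fin n₁) × EuclideanSpace ℝ (Fin n₂) =>
      f p.1 p.2 + g₁ p.1 + g₂ p.2) (div_pos hμ₂ hL₂) (by
    rintro ⟨u, v⟩
    have hle := le_convexCombo_lower_model (h := f x₁p) hg₂ hμ₂ hμL₂ hsm₂ hx₂p v
    have hmodel : f x₁p x₂ + ⟪gf2 x₁p x₂, v - x₂⟫ + μ₂ / 2 * ‖v - x₂‖ ^ 2 + g₂ v + g₁ x₁p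
        ≤ f u v + g₁ u + g₂ v := by
      have : 0 ≤ μ₁ / 2 * ‖u - x₁p‖ ^ 2 := by positivity
      linarith [hsc u x₁p v x₂, hopt₁ u]
    have := mul_le_mul_of_nonneg_left hmodel (div_pos hμ₂ hL₂).le
    linarith)
  have hcontr : 0 ≤ 1 - μ₂ / L₂ := sub_nonneg.2 ((div_le_one hL₂).2 hμL₂)
  refine step₂.trans ((mul_le_mul_of_nonneg_left step₁ hcontr).trans_eq ?_)
  ring
end

section
/- Let H be a real inner product space, μ ≥ 0, and f : H → ℝ differentiable satisfying f(x) ≥ f(y) + ⟨∇f(y), x − y⟩ + (μ/2)‖x − y‖² for all x, y. Let x* be a minimizer of f, let x⁰ ∈ H, let y⁰,…,y^{k−1} ∈ H and a₁,…,a_k ≥ 0 with A_k = a₁ + ⋯ + a_k > 0, and define ψ_k(x) = (1/2)‖x − x⁰‖² + Σ_{i=0}^{k−1} a_{i+1}[ f(y^i) + ⟨∇f(y^i), x − y^i⟩ + (μ/2)‖x − y^i‖² ]. If a point x^k ∈ H satisfies A_k f(x^k) ≤ inf_{x ∈ H} ψ_k(x), then f(x^k) − f(x*) ≤ ‖x*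 − x⁰‖²/(2 A_k). -/
open RealInnerProductSpace

/-- Let `f : H → ℝ` be `μ`-strongly convex (`μ ≥ 0`) with gradient `gf`,
`xs` a minimizer of `f`, and let `ψ_k(x) = ½‖x − x⁰‖² + Σ_{i<k} a_{i+1}[f(yⁱ) +
⟪∇f(yⁱ), x − yⁱ⟫ + (μ/2)‖x − yⁱ‖²]` with `a_{i+1} ≥ 0` and `A_k = Σ_{i<k} a_{i+1} > 0`.
If `A_k f(x^k) ≤ inf_x ψ_k(x)`, then `f(x^k) − f(xs) ≤ ‖xs − x⁰‖²/(2 A_k)`. -/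
theorem stmt_11 {H : Type*} [NormedAddCommGroup H] [InnerProductSpace ℝ H]
    (μ : ℝ) (hμ : 0 ≤ μ) (f : H → ℝ) (gf : H → H)
    (hsc : ∀ x y : H, f x ≥ f y + ⟪gf y, x - y⟫ + μ / 2 * ‖x - y‖ ^ 2)
    (xs : H) (hxs : ∀ x : H, f xs ≤ f x)
    (x0 : H) (k : ℕ) (y : ℕ → H) (a : ℕ → ℝ) (ha : ∀ i, i < k → 0 ≤ a (i + 1))
    (hAk : 0 < ∑ i ∈ Finset.range k, a (i + 1))
    (xk : H)
    (hψ : ∀ x : H,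
      (∑ i ∈ Finset.range k, a (i + 1)) * f xk ≤
        1 / 2 * ‖x - x0‖ ^ 2 +
          ∑ i ∈ Finset.range k,
            a (i + 1) * (f (y i) + ⟪gf (y i), x - y i⟫ + μ / 2 * ‖x - y i‖ ^ 2)) :
    f xk - f xs ≤ ‖xs - x0‖ ^ 2 / (2 * ∑ i ∈ Finset.range k, a (i + 1)) := by
  have hsum : ∑ i ∈ Finset.range k,
      a (i + 1) * (f (y i) + ⟪gf (y i), xs - y i⟫ + μ / 2 * ‖xs - y i‖ ^ 2) ≤
      (∑ i ∈ Finset.range k, a (i + 1)) * f xs := by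
    rw [Finset.sum_mul]
    exact Finset.sum_le_sum fun i hi =>
      mul_le_mul_of_nonneg_left (hsc xs (y i)) (ha i (Finset.mem_range.mp hi))
  rw [le_div_iff₀ (by positivity)]
  linarith [hψ xs]
end

section
/- Let H be a real inner product space, f : H → ℝ differentiable with f* = inf f > −∞, and μ > 0 such that the Polyak–Łojasiewicz inequality ‖∇f(y)‖² ≥ 2μ (f(y) − f*) holds for all y ∈ H. Let (a_k)_{k≥1} be positive reals with A_k = a₁ + ⋯ + a_k (A₀ = 0), and suppose a sequence (y^k)_{k≥0} satisfies f(y^{k+1}) ≤ f(y^k) − (a_{k+1}²/(2(A_k + a_{k+1}))) ‖∇f(y^k)‖² for all k ≥ 0, with μ a_{k+1}²/(A_k + a_{k+1}) ≤ 1. Then for every k ≥ 0, f(y^{k+1}) − f* ≤ (∏_{i=0}^{k} (1 − μ a_{i+1}²/(A_i + a_{i+1}))) · (f(y⁰) − f*). -/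
open RealInnerProductSpace

/-- Let `f : H → ℝ` have gradient `gf` and finite infimum `fstar`, and satisfy
the PL inequality `‖∇f(y)‖² ≥ 2μ(f y − fstar)` with `μ > 0`. If positive step sizes
`a_{k+1}` (with `A_k = Σ_{i<k} a_{i+1}`) and a sequence `(y^k)` satisfy the sufficient
decrease `f(y^{k+1}) ≤ f(y^k) − (a_{k+1}²/(2(A_k + a_{k+1})))‖∇f(y^k)‖²` and
`μ a_{k+1}²/(A_k + a_{k+1}) ≤ 1`, then
`f(y^{k+1}) − fstar ≤ (∏_{i≤k} (1 − μ a_{i+1}²/(A_i + a_{i+1})))(f(y⁰) − fstar)`. -/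
theorem stmt_12 {H : Type*} [NormedAddCommGroup H] [InnerProductSpace ℝ H]
    (f : H → ℝ) (gf : H → H) (fstar : ℝ) (hfstar : IsGLB (Set.range f) fstar)
    (μ : ℝ) (hμ : 0 < μ)
    (hPL : ∀ y : H, ‖gf y‖ ^ 2 ≥ 2 * μ * (f y - fstar))
    (a : ℕ → ℝ) (ha : ∀ k : ℕ, 0 < a (k + 1))
    (y : ℕ → H)
    (hdec : ∀ k : ℕ,
      f (y (k + 1)) ≤ f (y k) -
        a (k + 1) ^ 2 / (2 * ((∑ i ∈ Finset.range k, a (i + 1)) + a (k + 1))) *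
          ‖gf (y k)‖ ^ 2)
    (hstep : ∀ k : ℕ,
      μ * a (k + 1) ^ 2 / ((∑ i ∈ Finset.range k, a (i + 1)) + a (k + 1)) ≤ 1) :
    ∀ k : ℕ,
      f (y (k + 1)) - fstar ≤
        (∏ i ∈ Finset.range (k + 1),
          (1 - μ * a (i + 1) ^ 2 / ((∑ j ∈ Finset.range i, a (j + 1)) + a (i + 1)))) *
          (f (y 0) - fstar) := by
  have contraction : ∀ k : ℕ, f (y (k + 1)) - fstar ≤
      (1 - μ * a (k + 1) ^ 2 / ((∑ j ∈ Finset.range k, a (j + 1)) + a (k + 1))) *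
        (f (y k) - fstar) := by
    intro k
    have hA : 0 < (∑ j ∈ Finset.range k, a (j + 1)) + a (k + 1) :=
      add_pos_of_nonneg_of_pos (Finset.sum_nonneg fun j _ => (ha j).le) (ha k)
    have hd := hdec k
    generalize (∑ j ∈ Finset.range k, a (j + 1)) + a (k + 1) = A at hA hd ⊢
    have hc : 0 ≤ a (k + 1) ^ 2 / (2 * A) := by positivity
    have hPL' := mul_le_mul_of_nonneg_left (hPL (y k)) hc
    have hcoef : a (k + 1) ^ 2 / (2 * A) * (2 * μ * (f (y k) - fstar)) =
        μ * a (k + 1) ^ 2 / A * (f (y k) - fstar) := by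
      field_simp
    linarith
  intro k
  induction k with
  | zero => simpa using contraction 0
  | succ k ih =>
    rw [Finset.prod_range_succ, mul_right_comm, mul_comm]
    exact (contraction (k + 1)).trans
      (mul_le_mul_of_nonneg_left ih (sub_nonneg.mpr (hstep (k + 1))))
end

section
/- Suppose f is (μ₁,μ₂)-block strongly convex with μ₁, μ₂ > 0 and (L₁,L₂)-block smooth, g₁ and g₂ are convex, and Q₁ ⊆ H₁, Q₂ ⊆ H₂ are convex sets. Let x = (x₁⁺, x₂) with x₁⁺ ∈ Q₁, x₂ ∈ Q₂, where x₁⁺ satisfies the block-1 optimality condition ⟨∇₁f(x₁⁺, x₂), u − x₁⁺⟩ + g₁(u) − g₁(x₁⁺) ≥ 0 for all u ∈ Q₁. Let M₂ ≥ L₂, let T ∈ Q₂ minimize u ↦ ⟨∇₂f(x₁⁺, x₂), u − x₂⟩ + (M₂/2)‖u − x₂‖² + g₂(u) over Q₂, and set G = M₂(x₂ − T). Then for all (u,v) ∈ Q₁ × Q₂, F(u,v) ≥ F(x₁⁺, T) − (1/(2μ₂))‖G‖²; in particular ‖G‖² ≥ 2μ₂ ( F(x₁⁺, T) − F* ) where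 F* = inf_{Q₁×Q₂} F. -/
open RealInnerProductSpace

/-- A quadratic `a t + b t²` that is nonnegative on `(0, 1]` has nonnegative slope at `0`. -/
lemma nonneg_slope_of_quadratic_nonneg {a b : ℝ}
    (h : ∀ t : ℝ, 0 < t → t ≤ 1 → 0 ≤ t * a + t ^ 2 * b) : 0 ≤ a := by
  by_contra! ha
  have hb := abs_nonneg b
  have hpos : 0 < |b| - a := by linarith
  set t := -a / (|b| - a)
  have ht0 : 0 < t := div_pos (by linarith) hpos
  have ht1 : t ≤ 1 := (div_le_one hpos).2 (by linarith)
  have hmul : t * (|b| - a) = -a := div_mul_cancel₀ _ hpos.ne'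
  have hfac : 0 ≤ t * (a + t * b) := by linarith [h t ht0 ht1]
  have hsum : 0 ≤ a + t * b := nonneg_of_mul_nonneg_right hfac ht0
  have hle : t * b ≤ t * |b| := mul_le_mul_of_nonneg_left (le_abs_self b) ht0.le
  nlinarith

/-- First-order optimality condition for a proximal gradient step. -/
lemma prox_step_variational_inequality {H : Type*} [NormedAddCommGroup H]
    [InnerProductSpace ℝ H] {g : H → ℝ} {Q : Set H} (hQ : Convex ℝ Q)
    (hg : ConvexOn ℝ Set.univ g) {p x T : H} {M : ℝ} (hT : T ∈ Q)
    (hmin : ∀ u ∈ Q, ⟪p, T - x⟫ + M / 2 * ‖T - x‖ ^ 2 + g T ≤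
      ⟪p, u - x⟫ + M / 2 * ‖u - x‖ ^ 2 + g u) {v : H} (hv : v ∈ Q) :
    0 ≤ ⟪p, v - T⟫ + M * ⟪T - x, v - T⟫ + g v - g T := by
  refine nonneg_slope_of_quadratic_nonneg (b := M / 2 * ‖v - T‖ ^ 2) fun t ht0 ht1 => ?_
  have hcomb : (1 - t) • T + t • v = T + t • (v - T) := by module
  have hmem := hQ hT hv (sub_nonneg.2 ht1) ht0.le (by ring)
  have hconv := hg.2 (Set.mem_univ T) (Set.mem_univ v) (sub_nonneg.2 ht1) ht0.le (by ring)
  rw [hcomb] at hmem hconv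
  have hle := hmin _ hmem
  have hsub : T + t • (v - T) - x = (T - x) + t • (v - T) := by abel
  rw [hsub, norm_add_sq_real, inner_add_right, real_inner_smul_right, real_inner_smul_right,
    norm_smul, mul_pow, Real.norm_eq_abs, sq_abs] at hle
  simp only [smul_eq_mul] at hconv
  linarith

/-- Young's inequality in the form obtained by completing the square. -/
lemma inner_add_sq_ge_neg {H : Type*} [NormedAddCommGroup H] [InnerProductSpace ℝ H]
    {μ : ℝ} (hμ : 0 < μ) (a w : H) :
    -(1 / (2 * μ) * ‖a‖ ^ 2) ≤ ⟪a, w⟫ + μ / 2 * ‖w‖ ^ 2 := by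
  have hsq : ‖a + μ • w‖ ^ 2 = ‖a‖ ^ 2 + 2 * (μ * ⟪a, w⟫) + μ ^ 2 * ‖w‖ ^ 2 := by
    rw [norm_add_sq_real, real_inner_smul_right, norm_smul, mul_pow, Real.norm_eq_abs, sq_abs]
  have hid : ⟪a, w⟫ + μ / 2 * ‖w‖ ^ 2 + 1 / (2 * μ) * ‖a‖ ^ 2
      = 1 / (2 * μ) * ‖a + μ • w‖ ^ 2 := by
    rw [hsq]
    field_simp
    ring
  have hnonneg : 0 ≤ 1 / (2 * μ) * ‖a + μ • w‖ ^ 2 := by positivity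
  linarith

/-- Suppose `f` is (μ₁,μ₂)-block strongly convex (`μ₁, μ₂ > 0`) and
(L₁,L₂)-block smooth, `g₁, g₂` are convex, `Q₁, Q₂` are convex. Let `x = (x₁⁺, x₂)` with
`x₁⁺ ∈ Q₁` satisfying the block-1 optimality condition and `x₂ ∈ Q₂`. Let `M₂ ≥ L₂`, let
`T ∈ Q₂` minimize the `M₂`-proximal subproblem in block 2 over `Q₂`, and `G = M₂(x₂ − T)`.
Then `F(u,v) ≥ F(x₁⁺, T) − (1/(2μ₂))‖G‖²` for all `(u,v) ∈ Q₁ × Q₂`; in particular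
`‖G‖² ≥ 2μ₂ (F(x₁⁺, T) − F*)` where `F* = inf_{Q₁×Q₂} F`. -/
theorem stmt_13 {H₁ H₂ : Type*} [NormedAddCommGroup H₁] [InnerProductSpace ℝ H₁]
    [NormedAddCommGroup H₂] [InnerProductSpace ℝ H₂]
    (f : H₁ → H₂ → ℝ) (gf1 : H₁ → H₂ → H₁) (gf2 : H₁ → H₂ → H₂)
    (g₁ : H₁ → ℝ) (g₂ : H₂ → ℝ) (Q₁ : Set H₁) (Q₂ : Set H₂)
    (hQ₁ : Convex ℝ Q₁) (hQ₂ : Convex ℝ Q₂)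
    (hg₁ : ConvexOn ℝ Set.univ g₁) (hg₂ : ConvexOn ℝ Set.univ g₂)
    (μ₁ μ₂ L₁ L₂ : ℝ) (hμ₁ : 0 < μ₁) (hμ₂ : 0 < μ₂)
    (hsc : ∀ (u ξ : H₁) (v η : H₂),
      f u v ≥ f ξ η + ⟪gf1 ξ η, u - ξ⟫ + ⟪gf2 ξ η, v - η⟫
        + μ₁ / 2 * ‖u - ξ‖ ^ 2 + μ₂ / 2 * ‖v - η‖ ^ 2)
    (hsm : ∀ (u ξ : H₁) (v η : H₂),
      f u v ≤ f ξ η + ⟪gf1 ξ η, u - ξ⟫ + ⟪gf2 ξ η, v - η⟫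
        + L₁ / 2 * ‖u - ξ‖ ^ 2 + L₂ / 2 * ‖v - η‖ ^ 2)
    (x₁p : H₁) (x₂ : H₂) (hx₁p : x₁p ∈ Q₁) (hx₂ : x₂ ∈ Q₂)
    (hopt1 : ∀ u ∈ Q₁, ⟪gf1 x₁p x₂, u - x₁p⟫ + g₁ u - g₁ x₁p ≥ 0)
    (M₂ : ℝ) (hM₂ : M₂ ≥ L₂)
    (T : H₂) (hT : T ∈ Q₂)
    (hTmin : ∀ u ∈ Q₂,
      ⟪gf2 x₁p x₂, T - x₂⟫ + M₂ / 2 * ‖T - x₂‖ ^ 2 + g₂ T ≤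
        ⟪gf2 x₁p x₂, u - x₂⟫ + M₂ / 2 * ‖u - x₂‖ ^ 2 + g₂ u) :
    (∀ u ∈ Q₁, ∀ v ∈ Q₂,
        f u v + g₁ u + g₂ v ≥
          f x₁p T + g₁ x₁p + g₂ T - 1 / (2 * μ₂) * ‖M₂ • (x₂ - T)‖ ^ 2) ∧
      ‖M₂ • (x₂ - T)‖ ^ 2 ≥
        2 * μ₂ * (f x₁p T + g₁ x₁p + g₂ T -
          sInf {r : ℝ | ∃ u ∈ Q₁, ∃ v ∈ Q₂, r = f u v + g₁ u + g₂ v}) := by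
  have hbound : ∀ u ∈ Q₁, ∀ v ∈ Q₂, f u v + g₁ u + g₂ v ≥
      f x₁p T + g₁ x₁p + g₂ T - 1 / (2 * μ₂) * ‖M₂ • (x₂ - T)‖ ^ 2 := by
    intro u hu v hv
    have hlower := hsc u x₁p v x₂
    have hlowerT := hsc x₁p x₁p T x₂
    have hupperT := hsm x₁p x₁p T x₂
    simp only [sub_self, inner_zero_right, norm_zero] at hlowerT hupperT
    have hopt2 := prox_step_variational_inequality hQ₂ hg₂ hT hTmin hv
    have hyoung := inner_add_sq_ge_neg hμ₂ (M₂ • (x₂ - T)) (v - x₂)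
    have hM : L₂ * ‖T - x₂‖ ^ 2 ≤ M₂ * ‖T - x₂‖ ^ 2 := by gcongr
    have hμ : 0 ≤ μ₂ * ‖T - x₂‖ ^ 2 := by positivity
    have hξ : 0 ≤ μ₁ / 2 * ‖u - x₁p‖ ^ 2 := by positivity
    have hvx : v - x₂ = (v - T) + (T - x₂) := by abel
    have hinner : ⟪M₂ • (x₂ - T), v - x₂⟫
        = -(M₂ * ⟪T - x₂, v - T⟫) - M₂ * ‖T - x₂‖ ^ 2 := by
      rw [hvx, ← neg_sub T x₂, real_inner_smul_left, inner_neg_left, inner_add_right,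
        real_inner_self_eq_norm_sq]
      ring
    have hgrad : ⟪gf2 x₁p x₂, v - x₂⟫
        = ⟪gf2 x₁p x₂, v - T⟫ + ⟪gf2 x₁p x₂, T - x₂⟫ := by
      rw [hvx, inner_add_right]
    linarith [hopt1 u hu]
  refine ⟨hbound, ?_⟩
  have hinf : f x₁p T + g₁ x₁p + g₂ T - 1 / (2 * μ₂) * ‖M₂ • (x₂ - T)‖ ^ 2 ≤
      sInf {r : ℝ | ∃ u ∈ Q₁, ∃ v ∈ Q₂, r = f u v + g₁ u + g₂ v} := by
    refine le_csInf ⟨_, x₁p, hx₁p, x₂, hx₂, rfl⟩ ?_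
    rintro r ⟨u, hu, v, hv, rfl⟩
    exact hbound u hu v hv
  calc 2 * μ₂ * (f x₁p T + g₁ x₁p + g₂ T -
        sInf {r : ℝ | ∃ u ∈ Q₁, ∃ v ∈ Q₂, r = f u v + g₁ u + g₂ v})
      ≤ 2 * μ₂ * (1 / (2 * μ₂) * ‖M₂ • (x₂ - T)‖ ^ 2) := by
        gcongr
        linarith
    _ = ‖M₂ • (x₂ - T)‖ ^ 2 := by field_simp
end

section
/- Suppose f is (L₁,L₂)-block smooth, g₁ and g₂ are convex, Q₂ ⊆ H₂ is convex, x = (x₁,x₂) with x₂ ∈ Q₂, M₂ ≥ L₂ with M₂ > 0, T ∈ Q₂ minimizes u ↦ ⟨∇₂f(x), u − x₂⟩ + (M₂/2)‖u − x₂‖² + g₂(u) over Q₂, and G = M₂(x₂ − T). Then F(x₁, T) ≤ F(x) − (1/(2M₂))‖G‖², i.e. ‖G‖² ≤ 2M₂ ( F(x) − F(x₁, T) ). -/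
open RealInnerProductSpace

/-- A point of a convex set minimizing a linear function plus a scaled squared distance to `x`
plus a convex function satisfies the three-point inequality against the center `x`. -/
theorem inner_add_norm_sq_add_le_of_prox_min {H : Type*} [NormedAddCommGroup H]
    [InnerProductSpace ℝ H] {g : H → ℝ} {Q : Set H} (hg : ConvexOn ℝ Q g)
    {M : ℝ} (hM : 0 ≤ M) {p x T : H} (hx : x ∈ Q) (hT : T ∈ Q)
    (hmin : ∀ u ∈ Q, ⟪p, T - x⟫ + M / 2 * ‖T - x‖ ^ 2 + g T ≤
      ⟪p, u - x⟫ + M / 2 * ‖u - x‖ ^ 2 + g u) :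
    ⟪p, T - x⟫ + M * ‖T - x‖ ^ 2 + g T ≤ g x := by
  have key : ∀ t : ℝ, 0 < t → t ≤ 1 →
      ⟪p, T - x⟫ + M * ‖T - x‖ ^ 2 + g T - g x ≤ t * (M * ‖T - x‖ ^ 2 / 2) := by
    intro t ht ht1
    have hmem : (1 - t) • T + t • x ∈ Q :=
      hg.1 hT hx (by linarith) ht.le (by ring)
    have hconv : g ((1 - t) • T + t • x) ≤ (1 - t) * g T + t * g x := by
      simpa only [smul_eq_mul] using hg.2 hT hx (by linarith : 0 ≤ 1 - t) ht.le (by ring)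
    have hu := hmin _ hmem
    have hsub : (1 - t) • T + t • x - x = (1 - t) • (T - x) := by module
    rw [hsub, inner_smul_right, norm_smul, mul_pow, Real.norm_eq_abs, sq_abs] at hu
    refine le_of_mul_le_mul_left ?_ ht
    linarith
  by_contra! h
  set e := ⟪p, T - x⟫ + M * ‖T - x‖ ^ 2 + g T - g x with he
  have hepos : 0 < e := by linarith
  have hD : 0 ≤ M * ‖T - x‖ ^ 2 := by positivity
  have hs : 0 < e + M * ‖T - x‖ ^ 2 := by linarith
  have hk := key (e / (e + M * ‖T - x‖ ^ 2)) (by positivity)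
    ((div_le_one hs).2 (by linarith))
  rw [div_mul_eq_mul_div, le_div_iff₀ hs] at hk
  have := le_of_mul_le_mul_left hk hepos
  linarith

/-- Suppose `f` is (L₁,L₂)-block smooth, `g₁, g₂` are convex, `Q₂` is convex,
`x = (x₁,x₂)` with `x₂ ∈ Q₂`, `M₂ ≥ L₂` with `M₂ > 0`, `T ∈ Q₂` minimizes the `M₂`-proximal
subproblem in block 2 over `Q₂`, and `G = M₂(x₂ − T)`. Then
`F(x₁, T) ≤ F(x) − (1/(2M₂))‖G‖²`. -/
theorem stmt_14 {H₁ H₂ : Type*} [NormedAddCommGroup H₁] [InnerProductSpace ℝ H₁]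
    [NormedAddCommGroup H₂] [InnerProductSpace ℝ H₂]
    (f : H₁ → H₂ → ℝ) (gf1 : H₁ → H₂ → H₁) (gf2 : H₁ → H₂ → H₂)
    (g₁ : H₁ → ℝ) (g₂ : H₂ → ℝ) (Q₂ : Set H₂) (hQ₂ : Convex ℝ Q₂)
    (hg₁ : ConvexOn ℝ Set.univ g₁) (hg₂ : ConvexOn ℝ Set.univ g₂)
    (L₁ L₂ : ℝ)
    (hsm : ∀ (u ξ : H₁) (v η : H₂),
      f u v ≤ f ξ η + ⟪gf1 ξ η, u - ξ⟫ + ⟪gf2 ξ η, v - η⟫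
        + L₁ / 2 * ‖u - ξ‖ ^ 2 + L₂ / 2 * ‖v - η‖ ^ 2)
    (x₁ : H₁) (x₂ : H₂) (hx₂ : x₂ ∈ Q₂)
    (M₂ : ℝ) (hM₂L : M₂ ≥ L₂) (hM₂ : 0 < M₂)
    (T : H₂) (hT : T ∈ Q₂)
    (hTmin : ∀ u ∈ Q₂,
      ⟪gf2 x₁ x₂, T - x₂⟫ + M₂ / 2 * ‖T - x₂‖ ^ 2 + g₂ T ≤
        ⟪gf2 x₁ x₂, u - x₂⟫ + M₂ / 2 * ‖u - x₂‖ ^ 2 + g₂ u) :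
    f x₁ T + g₁ x₁ + g₂ T ≤
      (f x₁ x₂ + g₁ x₁ + g₂ x₂) - 1 / (2 * M₂) * ‖M₂ • (x₂ - T)‖ ^ 2 := by
  have hprox := inner_add_norm_sq_add_le_of_prox_min
    (hg₂.subset (Set.subset_univ Q₂) hQ₂) hM₂.le hx₂ hT hTmin
  have hdesc := hsm x₁ x₁ T x₂
  have hL : L₂ / 2 * ‖T - x₂‖ ^ 2 ≤ M₂ / 2 * ‖T - x₂‖ ^ 2 := by gcongr
  have hG : 1 / (2 * M₂) * ‖M₂ • (x₂ - T)‖ ^ 2 = M₂ / 2 * ‖T - x₂‖ ^ 2 := by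
    rw [norm_smul, mul_pow, Real.norm_eq_abs, sq_abs, norm_sub_rev]
    field_simp
  simp only [sub_self, inner_zero_right, norm_zero] at hdesc
  rw [hG]
  linarith
end

section
/- Suppose f is (μ₁,μ₂)-block strongly convex with μ₁, μ₂ > 0 and (L₁,L₂)-block smooth with L₁, L₂ > 0, g₁ and g₂ are convex, and Q₁ ⊆ H₁, Q₂ ⊆ H₂ are convex sets; let F* = inf_{Q₁×Q₂} F. Let x = (x₁,x₂) ∈ Q₁ × Q₂ satisfy the block-2 optimality condition ⟨∇₂f(x), v − x₂⟩ + g₂(v) − g₂(x₂) ≥ 0 for all v ∈ Q₂. Let x₁⁺ minimize u ↦ f(u, x₂) + g₁(u) over Q₁ and then let x₂⁺ minimize v ↦ f(x₁⁺, v) + g₂(v) over Q₂ (one alternating-minimization sweep). Then F(x₁⁺, x₂⁺) − F* ≤ (1 − μ₁/(L₁ + μ₁)) (1 − μ₂/(L₂ + μ₂)) · (F(x) − F*). -/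
open RealInnerProductSpace

/-- A quadratic upper bound along a segment, added to a convex function. -/
lemma segment_upper_bound {H : Type*} [NormedAddCommGroup H] [InnerProductSpace ℝ H]
    {φ g : H → ℝ} (hg : ConvexOn ℝ Set.univ g) {L : ℝ} {x p : H}
    (hsm : ∀ w, φ w ≤ φ x + ⟪p, w - x⟫ + L / 2 * ‖w - x‖ ^ 2)
    (u : H) {t : ℝ} (ht₀ : 0 ≤ t) (ht₁ : t ≤ 1) :
    φ (x + t • (u - x)) + g (x + t • (u - x)) ≤
      φ x + g x + t * (⟪p, u - x⟫ + g u - g x) + L / 2 * t ^ 2 * ‖u - x‖ ^ 2 := by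
  have hφ := hsm (x + t • (u - x))
  have hconv := hg.2 (Set.mem_univ x) (Set.mem_univ u) (sub_nonneg.2 ht₁) ht₀ (by ring)
  have heq : (1 - t) • x + t • u = x + t • (u - x) := by module
  rw [heq, smul_eq_mul, smul_eq_mul] at hconv
  rw [add_sub_cancel_left, inner_smul_right, norm_smul, mul_pow, Real.norm_eq_abs, sq_abs] at hφ
  linarith

/-- First-order optimality of a constrained minimizer of a smooth plus convex function. -/
lemma first_order_optimality {H : Type*} [NormedAddCommGroup H] [InnerProductSpace ℝ H]
    {φ g : H → ℝ} (hg : ConvexOn ℝ Set.univ g) {Q : Set H} (hQ : Convex ℝ Q)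
    {L : ℝ} (hL : 0 < L) {x p : H}
    (hsm : ∀ w, φ w ≤ φ x + ⟪p, w - x⟫ + L / 2 * ‖w - x‖ ^ 2)
    (hx : x ∈ Q) (hmin : ∀ u ∈ Q, φ x + g x ≤ φ u + g u) {u : H} (hu : u ∈ Q) :
    0 ≤ ⟪p, u - x⟫ + g u - g x := by
  by_contra! hneg
  set A := ⟪p, u - x⟫ + g u - g x with hA
  set B := L / 2 * ‖u - x‖ ^ 2 with hB
  have hB₀ : 0 ≤ B := by positivity
  have hden : 0 < B - A := by linarith
  set t := -A / (2 * (B - A)) with ht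
  have ht₀ : 0 < t := by apply div_pos <;> linarith
  have hmul : t * (2 * (B - A)) = -A := by rw [ht]; field_simp
  have ht₁ : t ≤ 1 := by rw [ht, div_le_one (by linarith)]; linarith
  have hup := segment_upper_bound hg hsm u ht₀.le ht₁
  have hlow := hmin _ (hQ.add_smul_sub_mem hx hu ⟨ht₀.le, ht₁⟩)
  have hnonneg : 0 ≤ t * (A + t * B) := by
    rw [← hA] at hup
    have : L / 2 * t ^ 2 * ‖u - x‖ ^ 2 = t * (t * B) := by rw [hB]; ring
    linarith
  have hstep : 0 ≤ A + t * B := nonneg_of_mul_nonneg_right hnonneg ht₀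
  nlinarith

/-- Decrease of the objective after exact minimization, relative to any value `V` dominating
the strongly convex lower model. -/
lemma minimization_decrease {H : Type*} [NormedAddCommGroup H] [InnerProductSpace ℝ H]
    {φ g : H → ℝ} (hg : ConvexOn ℝ Set.univ g) {Q : Set H} (hQ : Convex ℝ Q)
    {μ L : ℝ} (hμ : 0 < μ) (hL : 0 < L) {x y p : H}
    (hsm : ∀ w, φ w ≤ φ x + ⟪p, w - x⟫ + L / 2 * ‖w - x‖ ^ 2)
    (hx : x ∈ Q) (hmin : ∀ u ∈ Q, φ y + g y ≤ φ u + g u) {u : H} (hu : u ∈ Q) {V : ℝ}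
    (hV : φ x + ⟪p, u - x⟫ + μ / 2 * ‖u - x‖ ^ 2 + g u ≤ V) :
    φ y + g y ≤ (1 - μ / (L + μ)) * (φ x + g x) + μ / (L + μ) * V := by
  set t := μ / (L + μ) with ht
  have ht₀ : 0 ≤ t := by positivity
  have ht₁ : t ≤ 1 := by rw [ht, div_le_one (by positivity)]; linarith
  have hmul : t * (L + μ) = μ := by rw [ht]; field_simp
  have hLt : L * t ≤ μ := by nlinarith
  have hup := segment_upper_bound hg hsm u ht₀ ht₁
  have hlow := hmin _ (hQ.add_smul_sub_mem hx hu ⟨ht₀, ht₁⟩)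
  have hquad : L * t * (t * ‖u - x‖ ^ 2) ≤ μ * (t * ‖u - x‖ ^ 2) :=
    mul_le_mul_of_nonneg_right hLt (by positivity)
  have hVt := mul_le_mul_of_nonneg_left hV ht₀
  linarith

/-- A convex-combination bound against every element of a set passes to its infimum. -/
lemma sub_sInf_le_of_forall {S : Set ℝ} (hS : S.Nonempty) {a b t : ℝ} (ht : 0 < t)
    (h : ∀ r ∈ S, a ≤ (1 - t) * b + t * r) : a - sInf S ≤ (1 - t) * (b - sInf S) := by
  have hle : (a - (1 - t) * b) / t ≤ sInf S :=
    le_csInf hS fun r hr => by rw [div_le_iff₀ ht]; linarith [h r hr]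
  rw [div_le_iff₀ ht] at hle
  linarith

/-- Suppose `f` is (μ₁,μ₂)-block strongly convex (`μ₁, μ₂ > 0`) and
(L₁,L₂)-block smooth (`L₁, L₂ > 0`), `g₁, g₂` are convex, `Q₁, Q₂` are convex, and
`F* = inf_{Q₁×Q₂} F`. If `x = (x₁,x₂) ∈ Q₁ × Q₂` satisfies the block-2 optimality
condition and `(x₁⁺, x₂⁺)` is one alternating-minimization sweep over `Q₁`, `Q₂`,
then `F(x₁⁺, x₂⁺) − F* ≤ (1 − μ₁/(L₁+μ₁))(1 − μ₂/(L₂+μ₂))(F(x) − F*)`. -/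
theorem stmt_15 {H₁ H₂ : Type*} [NormedAddCommGroup H₁] [InnerProductSpace ℝ H₁]
    [NormedAddCommGroup H₂] [InnerProductSpace ℝ H₂]
    (f : H₁ → H₂ → ℝ) (gf1 : H₁ → H₂ → H₁) (gf2 : H₁ → H₂ → H₂)
    (g₁ : H₁ → ℝ) (g₂ : H₂ → ℝ) (Q₁ : Set H₁) (Q₂ : Set H₂)
    (hQ₁ : Convex ℝ Q₁) (hQ₂ : Convex ℝ Q₂)
    (hg₁ : ConvexOn ℝ Set.univ g₁) (hg₂ : ConvexOn ℝ Set.univ g₂)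
    (μ₁ μ₂ L₁ L₂ : ℝ) (hμ₁ : 0 < μ₁) (hμ₂ : 0 < μ₂) (hL₁ : 0 < L₁) (hL₂ : 0 < L₂)
    (hsc : ∀ (u ξ : H₁) (v η : H₂),
      f u v ≥ f ξ η + ⟪gf1 ξ η, u - ξ⟫ + ⟪gf2 ξ η, v - η⟫
        + μ₁ / 2 * ‖u - ξ‖ ^ 2 + μ₂ / 2 * ‖v - η‖ ^ 2)
    (hsm : ∀ (u ξ : H₁) (v η : H₂),
      f u v ≤ f ξ η + ⟪gf1 ξ η, u - ξ⟫ + ⟪gf2 ξ η, v - η⟫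
        + L₁ / 2 * ‖u - ξ‖ ^ 2 + L₂ / 2 * ‖v - η‖ ^ 2)
    (x₁ : H₁) (x₂ : H₂) (hx₁ : x₁ ∈ Q₁) (hx₂ : x₂ ∈ Q₂)
    (hopt : ∀ v ∈ Q₂, ⟪gf2 x₁ x₂, v - x₂⟫ + g₂ v - g₂ x₂ ≥ 0)
    (x₁p : H₁) (hx₁pQ : x₁p ∈ Q₁)
    (hx₁p : ∀ u ∈ Q₁, f x₁p x₂ + g₁ x₁p ≤ f u x₂ + g₁ u)
    (x₂p : H₂) (hx₂pQ : x₂p ∈ Q₂)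
    (hx₂p : ∀ v ∈ Q₂, f x₁p x₂p + g₂ x₂p ≤ f x₁p v + g₂ v) :
    f x₁p x₂p + g₁ x₁p + g₂ x₂p -
        sInf {r : ℝ | ∃ u ∈ Q₁, ∃ v ∈ Q₂, r = f u v + g₁ u + g₂ v} ≤
      (1 - μ₁ / (L₁ + μ₁)) * (1 - μ₂ / (L₂ + μ₂)) *
        ((f x₁ x₂ + g₁ x₁ + g₂ x₂) -
          sInf {r : ℝ | ∃ u ∈ Q₁, ∃ v ∈ Q₂, r = f u v + g₁ u + g₂ v}) := by
  set S := {r : ℝ | ∃ u ∈ Q₁, ∃ v ∈ Q₂, r = f u v + g₁ u + g₂ v}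
  have hS : S.Nonempty := ⟨_, x₁, hx₁, x₂, hx₂, rfl⟩
  have hsm₁ (ξ w : H₁) : f w x₂ ≤ f ξ x₂ + ⟪gf1 ξ x₂, w - ξ⟫ + L₁ / 2 * ‖w - ξ‖ ^ 2 := by
    simpa using hsm w ξ x₂ x₂
  have hsm₂ (w : H₂) :
      f x₁p w ≤ f x₁p x₂ + ⟪gf2 x₁p x₂, w - x₂⟫ + L₂ / 2 * ‖w - x₂‖ ^ 2 := by
    simpa using hsm x₁p x₁p w x₂
  have hdec₁ : f x₁p x₂ + g₁ x₁p + g₂ x₂ - sInf S ≤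
      (1 - μ₁ / (L₁ + μ₁)) * (f x₁ x₂ + g₁ x₁ + g₂ x₂ - sInf S) := by
    refine sub_sInf_le_of_forall hS (by positivity) ?_
    rintro _ ⟨u, hu, v, hv, rfl⟩
    have hv₀ : 0 ≤ μ₂ / 2 * ‖v - x₂‖ ^ 2 := by positivity
    have := minimization_decrease (φ := fun w => f w x₂) hg₁ hQ₁ hμ₁ hL₁ (hsm₁ x₁) hx₁ hx₁p hu
      (V := f u v + g₁ u + g₂ v - g₂ x₂) (by linarith [hsc u x₁ v x₂, hopt v hv])
    linarith
  have hdec₂ : f x₁p x₂p + g₁ x₁p + g₂ x₂p - sInf S ≤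
      (1 - μ₂ / (L₂ + μ₂)) * (f x₁p x₂ + g₁ x₁p + g₂ x₂ - sInf S) := by
    refine sub_sInf_le_of_forall hS (by positivity) ?_
    rintro _ ⟨u, hu, v, hv, rfl⟩
    have hu₀ : 0 ≤ μ₁ / 2 * ‖u - x₁p‖ ^ 2 := by positivity
    have hopt₁ := first_order_optimality (φ := fun w => f w x₂) hg₁ hQ₁ hL₁ (hsm₁ x₁p)
      hx₁pQ hx₁p hu
    have := minimization_decrease (φ := f x₁p) hg₂ hQ₂ hμ₂ hL₂ hsm₂ hx₂ hx₂p hv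
      (V := f u v + g₁ u + g₂ v - g₁ x₁p) (by linarith [hsc u x₁p v x₂])
    linarith
  have hfac : 0 ≤ 1 - μ₂ / (L₂ + μ₂) := by
    rw [sub_nonneg, div_le_one (by positivity)]
    linarith
  calc _ ≤ _ := hdec₂
    _ ≤ _ := mul_le_mul_of_nonneg_left hdec₁ hfac
    _ = _ := by ring
end

section
/- Let g : ℝⁿ → ℝ^m be differentiable with Jacobian J(x) = ∂g(x)/∂x ∈ ℝ^{m×n}, and suppose there is μ > 0 such that ⟨J(x) J(x)ᵀ v, v⟩ ≥ μ ‖v‖² for all x ∈ ℝⁿ and v ∈ ℝ^m (i.e. λ_min(J(x)J(x)ᵀ) ≥ μ). Then f(x) := ‖g(x)‖₂² satisfies the Polyak–Łojasiewicz inequality ‖∇f(x)‖₂² ≥ 4μ ( f(x) − f* ) for all x, where f* = inf f ≥ 0. -/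
open RealInnerProductSpace

/-- Let `g : ℝⁿ → ℝ^m` be differentiable with Jacobian `J x` at each `x`,
and suppose `⟪J(x) J(x)ᵀ v, v⟫ ≥ μ ‖v‖²` for all `x, v` with `μ > 0` (i.e.
`λ_min(J(x)J(x)ᵀ) ≥ μ`). Then `f x = ‖g x‖₂²` satisfies the Polyak–Łojasiewicz inequality
`‖∇f(x)‖₂² ≥ 4μ (f x − f*)` for all `x`, where `∇f(x) = 2 J(x)ᵀ g(x)` and `f* = inf f`. -/
theorem stmt_16 {n m : ℕ}
    (g : EuclideanSpace ℝ (Fin n) → EuclideanSpace ℝ (Fin m))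
    (J : EuclideanSpace ℝ (Fin n) → (EuclideanSpace ℝ (Fin n) →L[ℝ] EuclideanSpace ℝ (Fin m)))
    (hdiff : ∀ x, HasFDerivAt g (J x) x)
    (μ : ℝ) (hμ : 0 < μ)
    (hJ : ∀ (x : EuclideanSpace ℝ (Fin n)) (v : EuclideanSpace ℝ (Fin m)),
      ⟪J x (ContinuousLinearMap.adjoint (J x) v), v⟫ ≥ μ * ‖v‖ ^ 2) :
    ∀ x : EuclideanSpace ℝ (Fin n),
      ‖(2 : ℝ) • ContinuousLinearMap.adjoint (J x) (g x)‖ ^ 2 ≥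
        4 * μ * (‖g x‖ ^ 2 -
          sInf (Set.range fun z : EuclideanSpace ℝ (Fin n) => ‖g z‖ ^ 2)) := by
  intro x
  have h_inf : 0 ≤ sInf (Set.range fun z : EuclideanSpace ℝ (Fin n) => ‖g z‖ ^ 2) :=
    Real.sInf_nonneg (by rintro _ ⟨z, rfl⟩; positivity)
  have h_adj : μ * ‖g x‖ ^ 2 ≤ ‖ContinuousLinearMap.adjoint (J x) (g x)‖ ^ 2 := by
    rw [← real_inner_self_eq_norm_sq (ContinuousLinearMap.adjoint (J x) (g x)),
      ContinuousLinearMap.adjoint_inner_right]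
    exact hJ x (g x)
  rw [norm_smul, mul_pow, Real.norm_ofNat]
  nlinarith [mul_nonneg hμ.le h_inf]
end
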